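/- For a semigroup X the following conditions are equivalent: (1) φ(X) is a commutative Clifford semigroup; (2) φ(X) is an inverse semigroup; (3) the idempotents of the semigroup φ(X) commute and φ(X) is sub-Clifford or regular in N₂(X); (4) X is isomorphic to one of the semigroups C₂, Lₙ, or Lₙ⊔C₂ for some integer n ≥ 0. -/

import Mathlib

open Set

/-- An *upfamily* on `X`: a nonempty family of nonempty subsets of `X`
that is closed under taking supersets. -/
def IsUpfamily {X : Type*} (F : Set (Set X)) : Prop :=
  F.Nonempty ∧ (∀ A ∈ F, A.Nonempty) ∧ ∀ A ∈ F, ∀ B : Set X, A ⊆ B → B ∈ F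

/-- The space `υ(X)` of upfamilies on `X`. -/
def Upfamily (X : Type*) : Type _ := {F : Set (Set X) // IsUpfamily F}

/-- The extension of the binary operation of `X` to families of subsets of `X`:
`𝓐*𝓑 = ⟨⋃_{a ∈ A} a*B_a : A ∈ 𝓐, {B_a}_{a∈A} ⊆ 𝓑⟩`. -/
def upMul {X : Type*} [Mul X] (F G : Set (Set X)) : Set (Set X) :=
  {C | ∃ A ∈ F, ∃ B : X → Set X, (∀ a ∈ A, B a ∈ G) ∧ (⋃ a ∈ A, (fun y => a * y) '' B a) ⊆ C}

theorem IsUpfamily.upMul {X : Type*} [Mul X] {F G : Set (Set X)}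
    (hF : IsUpfamily F) (hG : IsUpfamily G) : IsUpfamily (upMul F G) := by
  obtain ⟨⟨A0, hA0⟩, hFne, hFup⟩ := hF
  obtain ⟨⟨B0, hB0⟩, hGne, hGup⟩ := hG
  refine ⟨⟨univ, A0, hA0, fun _ => B0, fun a _ => hB0, subset_univ _⟩, ?_, ?_⟩
  · rintro C ⟨A, hA, B, hB, hsub⟩
    obtain ⟨a, ha⟩ := hFne A hA
    obtain ⟨b, hb⟩ := hGne (B a) (hB a ha)
    exact ⟨a * b, hsub (mem_biUnion ha ⟨b, hb, rfl⟩)⟩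
  · rintro C ⟨A, hA, B, hB, hsub⟩ D hCD
    exact ⟨A, hA, B, hB, hsub.trans hCD⟩

/-- `υ(X)` is a semigroup under the extended operation. -/
instance {X : Type*} [Mul X] : Mul (Upfamily X) :=
  ⟨fun F G => ⟨upMul F.1 G.1, F.2.upMul G.2⟩⟩

/-- The embedding `X → υ(X)`, `x ↦ ⟨x⟩ = {A ⊆ X : x ∈ A}`. -/
def Upfamily.principal {X : Type*} (x : X) : Upfamily X :=
  ⟨{A | x ∈ A}, ⟨univ, mem_univ x⟩, fun A hA => ⟨x, hA⟩, fun _ hA _ hAB => hAB hA⟩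

/-- An upfamily is linked if any two of its members intersect. -/
def Upfamily.Linked {X : Type*} (F : Upfamily X) : Prop :=
  ∀ A ∈ F.1, ∀ B ∈ F.1, (A ∩ B).Nonempty

/-- Maximal linked upfamilies. -/
def Upfamily.IsMaxLinked {X : Type*} (F : Upfamily X) : Prop :=
  F.Linked ∧ ∀ G : Upfamily X, G.Linked → F.1 ⊆ G.1 → F = G

/-- Filters: upfamilies closed under binary intersections. -/
def Upfamily.IsFilter {X : Type*} (F : Upfamily X) : Prop :=
  ∀ A ∈ F.1, ∀ B ∈ F.1, A ∩ B ∈ F.1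

/-- Ultrafilters: maximal filters. -/
def Upfamily.IsUltrafilter {X : Type*} (F : Upfamily X) : Prop :=
  F.IsFilter ∧ ∀ G : Upfamily X, G.IsFilter → F.1 ⊆ G.1 → F = G

/-- The superextension `λ(X)` of maximal linked upfamilies. -/
def lambdaS (X : Type*) : Set (Upfamily X) := {F | F.IsMaxLinked}

/-- The semigroup `N₂(X)` of linked upfamilies. -/
def N2S (X : Type*) : Set (Upfamily X) := {F | F.Linked}

/-- The semigroup `φ(X)` of filters. -/
def phiS (X : Type*) : Set (Upfamily X) := {F | F.IsFilter}

/-- The Stone-Čech extension `β(X)` of ultrafilters. -/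
def betaS (X : Type*) : Set (Upfamily X) := {F | F.IsUltrafilter}

section SemigroupProps

variable {M : Type*} [Mul M]

/-- A subset closed under multiplication (i.e. a subsemigroup). -/
def mulClosed (S : Set M) : Prop := ∀ a ∈ S, ∀ b ∈ S, a * b ∈ S

/-- The operation is commutative on `S`. -/
def commOn (S : Set M) : Prop := ∀ a ∈ S, ∀ b ∈ S, a * b = b * a

/-- The idempotents of `S` commute. -/
def idemCommOn (S : Set M) : Prop :=
  ∀ a ∈ S, ∀ b ∈ S, a * a = a → b * b = b → a * b = b * a

/-- `S` is an inverse semigroup: every element has a unique inverse in `S`. -/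
def inverseOn (S : Set M) : Prop :=
  ∀ a ∈ S, ∃! b, b ∈ S ∧ a * b * a = a ∧ b * a * b = b

/-- `H` is a subgroup of the ambient multiplicative structure:
it is closed under multiplication and carries a group structure. -/
def IsSubgroupIn (H : Set M) : Prop :=
  (∀ a ∈ H, ∀ b ∈ H, a * b ∈ H) ∧
    ∃ e ∈ H, (∀ a ∈ H, e * a = a ∧ a * e = a) ∧ ∀ a ∈ H, ∃ b ∈ H, a * b = e ∧ b * a = e

/-- `S` is a Clifford semigroup: a union of groups. -/
def cliffordOn (S : Set M) : Prop := ∀ a ∈ S, ∃ H ⊆ S, IsSubgroupIn H ∧ a ∈ H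

/-- `S` is regular in `T`: every `a ∈ S` satisfies `a ∈ a T a`. -/
def regularIn (S T : Set M) : Prop := ∀ a ∈ S, ∃ b ∈ T, a * b * a = a

/-- `ppow a n = a^(n+1)`: positive powers in a semigroup. -/
def ppow (a : M) : ℕ → M
  | 0 => a
  | n + 1 => ppow a n * a

/-- `S` is sub-Clifford: `x^{n+1} = x^{m+1}` implies `x^n = x^m` for positive `n < m`. -/
def subCliffordOn (S : Set M) : Prop :=
  ∀ a ∈ S, ∀ n m : ℕ, n < m → ppow a (n + 1) = ppow a (m + 1) → ppow a n = ppow a m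

end SemigroupProps

/-- The cyclic group `Cₙ` of order `n`. -/
abbrev Cgrp (n : ℕ) : Type := Multiplicative (ZMod n)

/-- The linear semilattice `Lₙ = {0,…,n-1}` with the operation of minimum. -/
def L (n : ℕ) : Type := Fin n

instance {n : ℕ} : Mul (L n) :=
  ⟨fun a b => show Fin n from min (show Fin n from a) (show Fin n from b)⟩

/-- The disjoint ordered union `X ⊔ Y` of two semigroups, in which
`x * y = y * x = x` for `x ∈ X` and `y ∈ Y`. -/
abbrev OSum (A B : Type*) : Type _ := A ⊕ B

instance {A B : Type*} [Mul A] [Mul B] : Mul (OSum A B) :=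
  ⟨fun x y =>
    match x, y with
    | Sum.inl a, Sum.inl a' => Sum.inl (a * a')
    | Sum.inl a, Sum.inr _ => Sum.inl a
    | Sum.inr _, Sum.inl a => Sum.inl a
    | Sum.inr b, Sum.inr b' => Sum.inr (b * b')⟩

/-- `M` is isomorphic to the sub-semigroup `S` of `N`: there is an injective
operation-preserving map of `M` onto `S`. -/
def MulIsoOnto (M : Type*) [Mul M] {N : Type*} [Mul N] (S : Set N) : Prop :=
  ∃ f : M → N, Function.Injective f ∧ Set.range f = S ∧ ∀ x y : M, f (x * y) = f x * f y

section AbstractSemigroup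

variable {M : Type*} [Semigroup M] {S : Set M}

/-- A semigroup satisfying `a³ = a` is a union of groups. -/
theorem cliffordOn_of_cube (hmul : mulClosed S)
    (hcube : ∀ a ∈ S, a * a * a = a) : cliffordOn S := by
  intro a ha
  have h1 := hcube a ha
  have h2 : a * (a * a) = a := by rw [← mul_assoc, h1]
  have h3 : a * a * (a * a) = a * a := by rw [← mul_assoc, h1]
  refine ⟨{a, a * a}, ?_, ⟨?_, a * a, by simp, ?_, ?_⟩, by simp⟩
  · rintro x (rfl | rfl)
    exacts [ha, hmul _ ha _ ha]
  · rintro x (rfl | rfl) y (rfl | rfl) <;> simp [h1, h2, h3]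
  · rintro x (rfl | rfl)
    exacts [⟨h1, h2⟩, ⟨h3, h3⟩]
  · rintro x (rfl | rfl)
    exacts [⟨x, by simp, rfl, rfl⟩, ⟨a * a, by simp, h3, h3⟩]

theorem inverseOn_of_commOn (hcomm : commOn S) (hS : cliffordOn S) : inverseOn S := by
  intro a ha
  obtain ⟨H, hHS, ⟨-, e, -, he, hinv⟩, haH⟩ := hS a ha
  obtain ⟨b, hb, hab, hba⟩ := hinv a haH
  refine ⟨b, ⟨hHS hb, by rw [hab, (he a haH).1], by rw [hba, (he b hb).1]⟩, ?_⟩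
  rintro c ⟨hc, haca, hcac⟩
  have hca : c * a = e := by
    calc c * a = c * (a * e) := by rw [(he a haH).2]
      _ = (a * c) * (a * b) := by rw [← hab, ← mul_assoc, hcomm c hc a ha, mul_assoc, ← mul_assoc]
      _ = (a * c * a) * b := by simp only [mul_assoc]
      _ = e := by rw [haca, hab]
  calc c = e * c := by rw [← hca, hcac]
    _ = b * (c * a) := by rw [← hba, mul_assoc, hcomm a ha c hc]
    _ = b := by rw [hca, (he b hb).2]

/-- The product of two idempotents of an inverse semigroup is idempotent. -/
theorem inverseOn.mul_idem (hmul : mulClosed S) (hS : inverseOn S) {e f : M} (he : e ∈ S)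
    (hf : f ∈ S) (hee : e * e = e) (hff : f * f = f) : e * f * (e * f) = e * f := by
  obtain ⟨g, ⟨hg, h1, h2⟩, huniq⟩ := hS (e * f) (hmul _ he _ hf)
  have hee' (x : M) : e * (e * x) = e * x := by rw [← mul_assoc, hee]
  have hff' (x : M) : f * (f * x) = f * x := by rw [← mul_assoc, hff]
  have h2' (x : M) : g * (e * (f * (g * x))) = g * x := by
    simpa only [mul_assoc] using congrArg (· * x) h2
  have h1' : e * (f * (g * (e * f))) = e * f := by simpa only [mul_assoc] using h1
  have hfge : f * g * e = g := by
    refine huniq _ ⟨hmul _ (hmul _ hf _ hg) _ he, ?_, ?_⟩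
    · simp only [mul_assoc, hee', hff', h1']
    · simp only [mul_assoc, hee', hff', h2']
  have hgg : g * g = g := by
    calc g * g = f * g * e * (f * g * e) := by rw [hfge]
      _ = f * g * e := by simp only [mul_assoc, h2']
      _ = g := hfge
  have : e * f = g :=
    (hS g hg).unique ⟨hmul _ he _ hf, h2, h1⟩ ⟨hg, by rw [hgg, hgg], by rw [hgg, hgg]⟩
  rw [this, hgg]

theorem idemCommOn_of_inverseOn (hmul : mulClosed S) (hS : inverseOn S) : idemCommOn S := by
  intro e he f hf hee hff
  have h1 := hS.mul_idem hmul he hf hee hff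
  have h2 := hS.mul_idem hmul hf he hff hee
  have hee' (x : M) : e * (e * x) = e * x := by rw [← mul_assoc, hee]
  have hff' (x : M) : f * (f * x) = f * x := by rw [← mul_assoc, hff]
  refine (hS (e * f) (hmul _ he _ hf)).unique ⟨hmul _ he _ hf, by rw [h1, h1], by rw [h1, h1]⟩
    ⟨hmul _ hf _ he, ?_, ?_⟩
  · simpa only [mul_assoc, hee', hff'] using h1
  · simpa only [mul_assoc, hee', hff'] using h2

theorem ppow_mul_ppow (x : M) (m n : ℕ) : ppow x m * ppow x n = ppow x (m + n + 1) := by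
  induction n with
  | zero => rfl
  | succ n ih => rw [ppow, ← mul_assoc, ih]; rfl

/-- If the idempotents commute and `x³ = x` holds identically, the operation is commutative. -/
theorem mul_comm_of_cube (hidem : ∀ e f : M, e * e = e → f * f = f → e * f = f * e)
    (hcube : ∀ x : M, x * x * x = x) (x y : M) : x * y = y * x := by
  have hsq (z : M) : z * z * (z * z) = z * z := by rw [← mul_assoc, hcube]
  have key (p q : M) (hp : p * q * p = p) : p * p = p * q ∧ p * p = q * p := by
    have hpq : p * q * (p * q) = p * q := by rw [← mul_assoc, hp]
    have hqp : q * p * (q * p) = q * p := by rw [mul_assoc, ← mul_assoc p, hp]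
    constructor
    · calc p * p = p * q * (p * p) := by rw [← mul_assoc, hp]
        _ = p * p * (p * q) := hidem _ _ hpq (hsq p)
        _ = p * q := by rw [← mul_assoc, hcube]
    · calc p * p = p * (p * q * p) := by rw [hp]
        _ = p * p * (q * p) := by simp only [mul_assoc]
        _ = q * p * (p * p) := hidem _ _ (hsq p) hqp
        _ = q * (p * p * p) := by simp only [mul_assoc]
        _ = q * p := by rw [hcube]
  have inv (u v : M) : u * v * (v * u) * (u * v) = u * v := by
    calc u * v * (v * u) * (u * v) = u * ((v * v) * (u * u)) * v := by simp only [mul_assoc]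
      _ = (u * u * u) * (v * v * v) := by
        rw [hidem _ _ (hsq v) (hsq u)]; simp only [mul_assoc]
      _ = u * v := by rw [hcube, hcube]
  obtain ⟨-, h2⟩ := key _ _ (inv x y)
  obtain ⟨h3, -⟩ := key _ _ (inv y x)
  have hp := hcube (x * y)
  have hq := hcube (y * x)
  generalize x * y = p at h2 h3 hp ⊢
  generalize y * x = q at h2 h3 hq ⊢
  calc p = q * p * p := by rw [← h2, hp]
    _ = q * (q * q) := by rw [mul_assoc, h2, h3]
    _ = q := by rw [← mul_assoc, hq]

end AbstractSemigroup

namespace Upfamily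

variable {X : Type*}

/-- A proper filter, regarded as an upfamily. -/
def ofFilter (l : Filter X) [l.NeBot] : Upfamily X :=
  ⟨l.sets, ⟨univ, Filter.univ_mem⟩, fun _ hA => Filter.nonempty_of_mem hA,
    fun _ hA _ hAB => Filter.mem_of_superset hA hAB⟩

theorem ofFilter_mem_phiS (l : Filter X) [l.NeBot] : ofFilter l ∈ phiS X :=
  fun _ hA _ hB => Filter.inter_mem hA hB

theorem exists_ofFilter_eq {F : Upfamily X} (hF : F ∈ phiS X) :
    ∃ (l : Filter X) (_ : l.NeBot), ofFilter l = F := by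
  refine ⟨⟨F.1, ?_, fun hA hAB => F.2.2.2 _ hA _ hAB, fun hA hB => hF _ hA _ hB⟩, ⟨?_⟩, rfl⟩
  · obtain ⟨A, hA⟩ := F.2.1
    exact F.2.2.2 A hA _ (subset_univ A)
  · intro h
    exact not_nonempty_empty (F.2.2.1 ∅ (Filter.empty_mem_iff_bot.2 h))

theorem mem_mul [Mul X] {F G : Upfamily X} {C : Set X} :
    C ∈ (F * G).1 ↔ {a | {y | a * y ∈ C} ∈ G.1} ∈ F.1 := by
  constructor
  · rintro ⟨A, hA, B, hB, hC⟩
    refine F.2.2.2 A hA _ fun a ha => G.2.2.2 _ (hB a ha) _ fun y hy => hC ?_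
    exact mem_biUnion ha ⟨y, hy, rfl⟩
  · intro h
    refine ⟨_, h, fun a => {y | a * y ∈ C}, fun a ha => ha, ?_⟩
    simp only [iUnion_subset_iff, image_subset_iff]
    exact fun a _ y hy => hy

theorem mem_ofFilter_mul [Mul X] {l l' : Filter X} [l.NeBot] [l'.NeBot] {C : Set X} :
    C ∈ (ofFilter l * ofFilter l').1 ↔ ∀ᶠ a in l, ∀ᶠ b in l', a * b ∈ C :=
  mem_mul

theorem ext_mem {F G : Upfamily X} (h : ∀ C, C ∈ F.1 ↔ C ∈ G.1) : F = G :=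
  Subtype.ext (Set.ext h)

/-- The extended operation is associative. -/
abbrev semigroup (X : Type*) [Semigroup X] : Semigroup (Upfamily X) where
  mul_assoc F G H := ext_mem fun C => by simp only [mem_mul, mem_ofPred_eq, mul_assoc]

theorem mulClosed_phiS [Mul X] : mulClosed (phiS X) := by
  intro F hF G hG A hA B hB
  rw [mem_mul] at *
  refine F.2.2.2 _ (hF _ hA _ hB) _ fun a ha => ?_
  exact hG _ ha.1 _ ha.2

theorem phiS_subset_N2S : phiS X ⊆ N2S X :=
  fun F hF A hA B hB => F.2.2.1 _ (hF A hA B hB)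

/-- The filter of all supersets of a nonempty set. -/
def gen (A : Set X) (hA : A.Nonempty) : Upfamily X :=
  haveI := Filter.principal_neBot_iff.2 hA
  ofFilter (Filter.principal A)

theorem gen_mem_phiS (A : Set X) (hA : A.Nonempty) : gen A hA ∈ phiS X :=
  haveI := Filter.principal_neBot_iff.2 hA
  ofFilter_mem_phiS _

theorem mem_gen {A : Set X} {hA : A.Nonempty} {C : Set X} : C ∈ (gen A hA).1 ↔ A ⊆ C := Iff.rfl

theorem gen_inj {A B : Set X} {hA : A.Nonempty} {hB : B.Nonempty} :
    gen A hA = gen B hB ↔ A = B := by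
  refine ⟨fun h => ?_, fun h => by subst h; rfl⟩
  have h' (C : Set X) : A ⊆ C ↔ B ⊆ C := by rw [← mem_gen (hA := hA), h, mem_gen]
  exact ((h' B).2 subset_rfl).antisymm ((h' A).1 subset_rfl)

open scoped Pointwise in
theorem gen_mul_gen [Mul X] {A B : Set X} (hA : A.Nonempty) (hB : B.Nonempty) :
    gen A hA * gen B hB = gen (A * B) (hA.mul hB) :=
  ext_mem fun _ => by
    rw [mem_mul, mem_gen, mem_gen, mul_subset_iff]
    rfl

theorem exists_gen_eq [Finite X] {F : Upfamily X} (hF : F ∈ phiS X) :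
    ∃ A hA, gen A hA = F := by
  obtain ⟨l, hl, rfl⟩ := exists_ofFilter_eq hF
  have hker : ⋂₀ l.sets ∈ l := (Filter.sInter_mem (toFinite _)).2 fun _ h => h
  exact ⟨_, Filter.nonempty_of_mem hker, ext_mem fun C =>
    ⟨fun h => Filter.mem_of_superset hker h, fun h => sInter_subset_of_mem h⟩⟩

end Upfamily

open Upfamily

section Consequences

variable {X : Type*} [Semigroup X]

open scoped Pointwise

theorem idem_comm_of_phiS (h : idemCommOn (phiS X)) (e f : X) (he : e * e = e) (hf : f * f = f) :
    e * f = f * e := by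
  have key := h _ (gen_mem_phiS {e} (singleton_nonempty e)) _
    (gen_mem_phiS {f} (singleton_nonempty f))
    (by rw [gen_mul_gen, gen_inj, singleton_mul_singleton, he])
    (by rw [gen_mul_gen, gen_inj, singleton_mul_singleton, hf])
  simpa [gen_mul_gen, gen_inj] using key

theorem subCliffordOn.mul_self {M : Type*} [Mul M] {S : Set M} (h : subCliffordOn S) {a : M}
    (ha : a ∈ S) (h2 : a * a = a * a * a) : a = a * a :=
  h a ha 0 1 one_pos h2

theorem subCliffordOn.set_mul_self (h : subCliffordOn (phiS X)) {A : Set X} (hA : A.Nonempty)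
    (h2 : A * A = A * A * A) : A = A * A := by
  have key := h.mul_self (gen_mem_phiS A hA)
    (by rw [gen_mul_gen, gen_mul_gen, gen_inj]; exact h2)
  rwa [gen_mul_gen, gen_inj] at key

/-- In a semigroup with sub-Clifford semigroup of filters every element has finite order:
apply the hypothesis to the filter of sets containing almost all powers `xⁿ` with
`n ≡ 0, 1 (mod 3)`. -/
theorem subCliffordOn.exists_ppow_eq (h : subCliffordOn (phiS X)) (x : X) :
    ∃ m n, m < n ∧ ppow x m = ppow x n := by
  let _ := Upfamily.semigroup X
  set s : Filter ℕ := Filter.atTop ⊓ Filter.principal {n | n % 3 ≠ 1} with hs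
  have ev (p : ℕ → Prop) : (∀ᶠ n in s, p n) ↔ ∃ N, ∀ n ≥ N, n % 3 ≠ 1 → p n := by
    rw [hs, Filter.eventually_inf_principal, Filter.eventually_atTop]; rfl
  have : s.NeBot := by
    rw [Filter.neBot_iff]
    intro hbot
    have : ∀ᶠ n in s, False := by rw [hbot]; exact Filter.eventually_bot
    obtain ⟨N, hN⟩ := (ev _).1 this
    exact hN (3 * N) (by omega) (by omega)
  set F := ofFilter (s.map (ppow x))
  set G := ofFilter ((Filter.atTop : Filter ℕ).map (ppow x))
  have hFF : F * F = G := by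
    refine ext_mem fun C => ?_
    rw [mem_ofFilter_mul]
    change (∀ᶠ a in s, ∀ᶠ b in s, ppow x a * ppow x b ∈ C) ↔ ∀ᶠ n in Filter.atTop, ppow x n ∈ C
    simp only [ppow_mul_ppow, ev, Filter.eventually_atTop]
    constructor
    · rintro ⟨N, hN⟩
      obtain ⟨M, hM⟩ := hN (3 * N) (by omega) (by omega)
      obtain ⟨M', hM'⟩ := hN (3 * N + 2) (by omega) (by omega)
      refine ⟨3 * N + 3 + M + M', fun n hn => ?_⟩
      by_cases hn3 : n % 3 = 2
      · have := hM' (n - (3 * N + 3)) (by omega) (by omega)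
        rwa [show 3 * N + 2 + (n - (3 * N + 3)) + 1 = n by omega] at this
      · have := hM (n - (3 * N + 1)) (by omega) (by omega)
        rwa [show 3 * N + (n - (3 * N + 1)) + 1 = n by omega] at this
    · rintro ⟨N, hN⟩
      exact ⟨0, fun a _ _ => ⟨N, fun b hb _ => hN _ (by omega)⟩⟩
  have hFG : F * G = G := by
    refine ext_mem fun C => ?_
    rw [mem_ofFilter_mul]
    change (∀ᶠ a in s, ∀ᶠ b in Filter.atTop, ppow x a * ppow x b ∈ C) ↔
      ∀ᶠ n in Filter.atTop, ppow x n ∈ C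
    simp only [ppow_mul_ppow, ev, Filter.eventually_atTop]
    constructor
    · rintro ⟨N, hN⟩
      obtain ⟨M, hM⟩ := hN (3 * N) (by omega) (by omega)
      refine ⟨3 * N + 1 + M, fun n hn => ?_⟩
      have := hM (n - (3 * N + 1)) (by omega)
      rwa [show 3 * N + (n - (3 * N + 1)) + 1 = n by omega] at this
    · rintro ⟨N, hN⟩
      exact ⟨0, fun a _ _ => ⟨N, fun b hb => hN _ (by omega)⟩⟩
  have hF : F = F * F := h.mul_self (ofFilter_mem_phiS _) (by rw [mul_assoc, hFF, hFG])
  have hmem : ppow x '' {n | n % 3 ≠ 1} ∈ F.1 := by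
    change ∀ᶠ n in s, ppow x n ∈ ppow x '' {n | n % 3 ≠ 1}
    exact (ev _).2 ⟨0, fun n _ hn => mem_image_of_mem _ hn⟩
  rw [hF, hFF] at hmem
  obtain ⟨N, hN⟩ := Filter.eventually_atTop.1
    (show ∀ᶠ n in Filter.atTop, ppow x n ∈ ppow x '' {n | n % 3 ≠ 1} from hmem)
  obtain ⟨m, hm, hmn⟩ := hN (3 * N + 1) (by omega)
  have hne : m ≠ 3 * N + 1 := fun h => hm (by omega)
  rcases hne.lt_or_gt with hlt | hlt
  exacts [⟨_, _, hlt, hmn⟩, ⟨_, _, hlt, hmn.symm⟩]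

theorem subCliffordOn.cube (h : subCliffordOn (phiS X)) (x : X) : x * x * x = x := by
  obtain ⟨k, hk⟩ : ∃ k, x = ppow x (k + 1) := by
    have desc (m : ℕ) : ∀ n, m < n → ppow x m = ppow x n → ∃ k, x = ppow x (k + 1) := by
      induction m with
      | zero => exact fun n hn hx => ⟨n - 1, by rwa [Nat.sub_add_cancel hn]⟩
      | succ m ih =>
        intro n hn hx
        obtain ⟨n, rfl⟩ := Nat.exists_eq_add_one.2 (Nat.zero_lt_of_lt hn)
        refine ih n (by omega) ?_
        have hgen (j : ℕ) : ppow (gen {x} (singleton_nonempty x)) j =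
            gen {ppow x j} (singleton_nonempty _) := by
          induction j with
          | zero => rfl
          | succ j ihj => rw [ppow, ihj, gen_mul_gen, gen_inj, singleton_mul_singleton]; rfl
        have := h _ (gen_mem_phiS {x} (singleton_nonempty x)) m n (by omega)
          (by rw [hgen, hgen, gen_inj, hx])
        simpa [hgen, gen_inj] using this
    obtain ⟨m, n, hmn, hx⟩ := h.exists_ppow_eq x
    exact desc m n hmn hx
  set e := ppow x k with he
  have hex : e * x = x := hk.symm
  have heT (n : ℕ) : e * ppow x n = ppow x n := by
    induction n with
    | zero => exact hex
    | succ n ih => rw [ppow, ← mul_assoc, ih]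
  by_cases hxe : x * x = e
  · rw [hxe, hex]
  by_cases hxx : x * x = x
  · rw [hxx, hxx]
  exfalso
  set T := range (ppow x)
  have hTT {a b : X} (ha : a ∈ T) (hb : b ∈ T) : a * b ∈ T := by
    obtain ⟨m, rfl⟩ := ha
    obtain ⟨n, rfl⟩ := hb
    exact ⟨_, (ppow_mul_ppow x m n).symm⟩
  have hxT : x ∈ T := ⟨0, rfl⟩
  have hx2T : x * x ∈ T := ⟨1, rfl⟩
  set A := T \ {x * x}
  have hxA : x ∈ A := ⟨hxT, fun h => hxx h.symm⟩
  have heA : e ∈ A := ⟨⟨k, rfl⟩, fun h => hxe h.symm⟩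
  have hAA : A * A = T := by
    refine Subset.antisymm (mul_subset_iff.2 fun a ha b hb => hTT ha.1 hb.1) fun t ht => ?_
    by_cases htx : t = x * x
    · exact ⟨x, hxA, x, hxA, htx.symm⟩
    · obtain ⟨n, rfl⟩ := ht
      exact ⟨e, heA, ppow x n, ⟨⟨n, rfl⟩, htx⟩, heT n⟩
  have hTA : T = T * A := by
    refine Subset.antisymm ?_ (mul_subset_iff.2 fun a ha b hb => hTT ha hb.1)
    rintro t ⟨n, rfl⟩
    refine ⟨ppow x n, ⟨n, rfl⟩, e, heA, ?_⟩
    change ppow x n * ppow x k = ppow x n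
    rw [ppow_mul_ppow, Nat.add_comm n k, ← ppow_mul_ppow]
    exact heT n
  have := h.set_mul_self ⟨x, hxA⟩ (by rw [hAA]; exact hTA)
  rw [hAA] at this
  exact (this ▸ hx2T : x * x ∈ A).2 rfl

/-- What regularity in `N₂(X)` says about the filter generated by a set. -/
theorem regularIn.exists_mul_mem (h : regularIn (phiS X) (N2S X)) {A : Set X} {a a' : X}
    (ha : a ∈ A) (ha' : a' ∈ A) : ∃ b, ∀ c ∈ A, a * b * c ∈ A ∧ a' * b * c ∈ A := by
  obtain ⟨B, hB, hBA⟩ := h _ (gen_mem_phiS A ⟨a, ha⟩)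
  have hmem : A ∈ (gen A ⟨a, ha⟩ * B * gen A ⟨a, ha⟩).1 := by rw [hBA]; exact Subset.refl A
  rw [Upfamily.mem_mul, Upfamily.mem_mul] at hmem
  obtain ⟨b, hb, hb'⟩ := hB _ (hmem ha) _ (hmem ha')
  exact ⟨b, fun c hc => ⟨hb hc, hb' hc⟩⟩

theorem regularIn.cube (hidem : ∀ e f : X, e * e = e → f * f = f → e * f = f * e)
    (h : regularIn (phiS X) (N2S X)) (x : X) : x * x * x = x := by
  obtain ⟨y, hxyx, hyxy⟩ : ∃ y, x * y * x = x ∧ y * x * y = y := by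
    obtain ⟨b, hb⟩ := h.exists_mul_mem (mem_singleton x) (mem_singleton x)
    have hb : x * b * x = x := (hb x rfl).1
    have hb' : x * (b * x) = x := by rw [← mul_assoc, hb]
    refine ⟨b * x * b, ?_, ?_⟩
    · rw [← mul_assoc, ← mul_assoc, hb, hb]
    · calc b * x * b * x * (b * x * b) = b * (x * b * x) * b * x * b := by simp only [mul_assoc]
        _ = b * (x * b * x) * b := by simp only [mul_assoc, hb']
        _ = b * x * b := by rw [hb]
  have hxy : x * y = y * x := by
    have hef : x * y * (y * x) = y * x * (x * y) :=
      hidem _ _ (by rw [← mul_assoc, hxyx]) (by rw [← mul_assoc, hyxy])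
    obtain ⟨b, hb⟩ := h.exists_mul_mem (A := {x, y}) (mem_insert x _) (mem_insert_of_mem x rfl)
    obtain ⟨h1, h2⟩ := hb x (mem_insert x _)
    obtain ⟨h3, -⟩ := hb y (mem_insert_of_mem x rfl)
    have left_x (z : X) (hz : x * z = y) : x * y * (y * x) = y * x := by
      rw [← mul_assoc, show x * y * y = y by rw [← hz, ← mul_assoc, hz, hxyx, hz]]
    have right_x (z : X) (hz : z * x = y) : x * y * (y * x) = x * y := by
      rw [mul_assoc x, show y * (y * x) = y by
        rw [← hz, mul_assoc z x, hz, ← mul_assoc x, hxyx, hz]]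
    have right_y (z : X) (hz : z * y = x) : x * y * (y * x) = y * x := by
      rw [hef, mul_assoc y, show x * (x * y) = x by
        rw [← hz, mul_assoc z y, hz, ← mul_assoc y, hyxy, hz]]
    have left_y (z : X) (hz : y * z = x) : x * y * (y * x) = x * y := by
      rw [hef, ← mul_assoc, show y * x * x = x by rw [← hz, ← mul_assoc, hz, hyxy, hz]]
    rw [mul_assoc] at h1 h2 h3
    have hf : x * y * (y * x) = y * x := by
      rcases h1 with h1 | h1
      · rcases h3 with h3 | h3
        exacts [right_y (x * b) (by rw [mul_assoc]; exact h3), left_x _ h3]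
      · exact left_x _ h1
    have he : x * y * (y * x) = x * y := by
      rcases h2 with h2 | h2
      exacts [left_y _ h2, right_x (y * b) (by rw [mul_assoc]; exact h2)]
    exact he.symm.trans hf
  have hex : x * y * x = x := hxyx
  have hxe : x * (x * y) = x := by rw [hxy, ← mul_assoc, hxyx]
  obtain ⟨b, hb⟩ := h.exists_mul_mem (A := {x * y, x}) (mem_insert _ _) (mem_insert_of_mem _ rfl)
  obtain ⟨h1, -⟩ := hb (x * y) (mem_insert _ _)
  obtain ⟨h2, h3⟩ := hb x (mem_insert_of_mem _ rfl)
  have hsq : x * x ∈ ({x * y, x} : Set X) := by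
    rcases h1 with h1 | h1
    · have : x * b * x = x * (x * y * b * (x * y)) * x := by
        calc x * b * x = x * (x * y) * b * (x * y * x) := by rw [hxe, hex]
          _ = _ := by simp only [mul_assoc]
      rw [this, h1, hxe] at h3
      exact h3
    · have h1 : x * y * b * (x * y) = x := h1
      rwa [show x * y * b * x = x * x by
        calc x * y * b * x = x * y * b * (x * y * x) := by rw [hex]
          _ = x * y * b * (x * y) * x := by simp only [mul_assoc]
          _ = x * x := by rw [h1]] at h2
  rcases hsq with hsq | hsq
  · rw [hsq, hxyx]
  · have hsq : x * x = x := hsq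
    rw [hsq, hsq]

theorem set_mul_self_eq {A T : Set X} (h1 : ∀ a ∈ A, ∀ b ∈ A, a * b ∈ T)
    (h2 : ∀ t ∈ T, ∃ a ∈ A, ∃ b ∈ A, a * b = t) (h3 : ∀ t ∈ T, ∀ a ∈ A, t * a ∈ T)
    (h4 : ∀ t ∈ T, ∃ s ∈ T, ∃ a ∈ A, s * a = t) : A * A = A * A * A := by
  have hT : A * A = T := (mul_subset_iff.2 h1).antisymm h2
  rw [hT]
  exact Subset.antisymm h4 (mul_subset_iff.2 h3)

theorem exists_mul_mem (h : subCliffordOn (phiS X) ∨ regularIn (phiS X) (N2S X)) {A : Set X}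
    (hA : A * A = A * A * A) {a a' : X} (ha : a ∈ A) (ha' : a' ∈ A) :
    ∃ b, ∀ c ∈ A, a * b * c ∈ A ∧ a' * b * c ∈ A := by
  rcases h with h | h
  · have hAA := h.set_mul_self ⟨a, ha⟩ hA
    have hmul {u v : X} (hu : u ∈ A) (hv : v ∈ A) : u * v ∈ A := by
      rw [hAA]
      exact mul_mem_mul hu hv
    exact ⟨a, fun c hc => ⟨hmul (hmul ha ha) hc, hmul (hmul ha' ha) hc⟩⟩
  · exact h.exists_mul_mem ha ha'

/-- The idempotents form a linear semilattice. -/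
theorem idem_mul_eq_or (h : subCliffordOn (phiS X) ∨ regularIn (phiS X) (N2S X))
    (hcomm : ∀ x y : X, x * y = y * x) {e f : X} (he : e * e = e) (hf : f * f = f) :
    e * f = e ∨ e * f = f := by
  have hfe : f * e = e * f := hcomm f e
  have h1 : e * (e * f) = e * f := by rw [← mul_assoc, he]
  have h2 : e * f * f = e * f := by rw [mul_assoc, hf]
  have h3 : e * f * e = e * f := by rw [hcomm, h1]
  obtain ⟨b, hb⟩ := exists_mul_mem h (A := {e, f}) (a := e) (a' := f)
    (set_mul_self_eq (T := {e, f, e * f}) (by simp [he, hf, hfe]) (by simp [he, hf, hfe])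
      (by simp [he, hf, hfe, h2, h3]) (by simp [he, hf, hfe, h2, h3])) (by simp) (by simp)
  obtain ⟨hee, hef⟩ := hb e (by simp)
  obtain ⟨hef', hff⟩ := hb f (by simp)
  have heb : e * b * e = e * b := by rw [hcomm, ← mul_assoc, he]
  have hfb : f * b * f = f * b := by rw [hcomm, ← mul_assoc, hf]
  rw [heb] at hee
  rw [hfb] at hff
  rcases hee with hee | hee
  · rw [hee] at hef'
    exact hef'
  · have hee : e * b = f := hee
    right
    rw [← hee, ← mul_assoc, he]

/-- The maximal subgroups have at most two elements. -/
theorem mul_eq_of_sq_eq (h : subCliffordOn (phiS X) ∨ regularIn (phiS X) (N2S X))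
    (hcomm : ∀ x y : X, x * y = y * x) (hcube : ∀ x : X, x * x * x = x) {x y : X}
    (hxy : y * y = x * x) : x * y = x * x ∨ x * y = x ∨ x * y = y := by
  generalize he : x * x = e at hxy ⊢
  have hex : e * x = x := by rw [← he, hcube]
  have hxe : x * e = x := by rw [hcomm, hex]
  have hey : e * y = y := by rw [← hxy, hcube]
  have hye : y * e = y := by rw [hcomm, hey]
  have hee : e * e = e := by rw [← he, ← mul_assoc, hcube]
  have hyx : y * x = x * y := hcomm y x
  have h1 : x * y * x = y := by rw [hcomm, ← mul_assoc, he, hey]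
  have h2 : x * y * y = x := by rw [mul_assoc, hxy, hxe]
  have h3 : x * y * e = x * y := by rw [mul_assoc, hye]
  obtain ⟨b, hb⟩ := exists_mul_mem h (A := {e, x, y}) (a := e) (a' := x)
    (set_mul_self_eq (T := {e, x, y, x * y})
      (by simp [he, hex, hxe, hey, hye, hee, hxy, hyx])
      (by simp [he, hex, hxe, hey, hye, hee, hxy, hyx])
      (by simp [he, hex, hxe, hey, hye, hee, hxy, hyx, h1, h2, h3])
      (by simp [he, hex, hxe, hey, hye, hee, hxy, hyx, h1, h2, h3])) (by simp) (by simp)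
  have heb : e * b * e = e * b := by rw [hcomm, ← mul_assoc, hee]
  have hmem := (hb e (by simp)).1
  rw [heb] at hmem
  rcases hmem with hmem | hmem | hmem
  · have := (hb y (by simp)).2
    rwa [← hxe, mul_assoc x, hmem, hxe] at this
  · have := (hb y (by simp)).1
    rwa [hmem] at this
  · have := (hb x (by simp)).1
    rwa [show e * b = y from hmem, hyx] at this

/-- Nontrivial maximal subgroups occur only at the greatest idempotent. -/
theorem sq_eq_of_sq_mul_eq (h : subCliffordOn (phiS X) ∨ regularIn (phiS X) (N2S X))
    (hcomm : ∀ x y : X, x * y = y * x) (hcube : ∀ x : X, x * x * x = x) {x f : X}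
    (hf : f * f = f) (hxf : x * x * f = x * x) : x * x = x ∨ x * x = f := by
  generalize he : x * x = e at hxf ⊢
  have hex : e * x = x := by rw [← he, hcube]
  have hxe : x * e = x := by rw [hcomm, hex]
  have hfe : f * e = e := by rw [hcomm, hxf]
  have hxf' : x * f = x := by rw [← hxe, mul_assoc, hxf]
  have hfx : f * x = x := by rw [hcomm, hxf']
  obtain ⟨b, hb⟩ := exists_mul_mem h (A := {x, f}) (a := x) (a' := f)
    (set_mul_self_eq (T := {e, x, f}) (by simp [he, hf, hxf', hfx])
      (by simp [he, hf, hxf', hfx]) (by simp [he, hf, hex, hxf, hxf', hfx])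
      (by simp [he, hf, hex, hxf, hxf', hfx])) (by simp) (by simp)
  have hmem := (hb f (by simp)).2
  rcases hmem with hmem | hmem
  · have := (hb f (by simp)).1
    rwa [← hxf', mul_assoc x, mul_assoc x, hmem, he, hxf'] at this
  · have := (hb x (by simp)).1
    have hxbx : x * b * x = e := by
      calc x * b * x = x * f * b * (f * x) := by rw [hxf', hfx]
        _ = x * (f * b * f) * x := by simp only [mul_assoc]
        _ = e := by rw [show f * b * f = f from hmem, hxf', he]
    rwa [hxbx] at this

/-- The filters of sets containing almost all even-indexed, respectively odd-indexed, members of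
a monotone sequence of idempotents do not commute. -/
theorem finite_idem (h : idemCommOn (phiS X))
    (hlin : ∀ e f : X, e * e = e → f * f = f → e * f = e ∨ e * f = f) :
    {e : X | e * e = e}.Finite := by
  by_contra hinf
  have hinf : {e : X | e * e = e}.Infinite := hinf
  obtain ⟨u, hu, hmono⟩ : ∃ u : ℕ → X, Function.Injective u ∧
      ((∀ m n, m < n → u m * u n = u m) ∨ ∀ m n, m < n → u m * u n = u n) := by
    set s := hinf.natEmbedding
    have : IsTrans X (fun a b => a * b = a) :=
      ⟨fun a b c hab hbc => by rw [← hab, mul_assoc, hbc]⟩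
    obtain ⟨g, hg⟩ := exists_increasing_or_nonincreasing_subseq (fun a b : X => a * b = a)
      (fun n => (s n : X))
    refine ⟨fun n => s (g n), fun m n hmn => g.injective (s.injective (Subtype.ext hmn)), ?_⟩
    refine hg.imp id fun hg m n hmn => ?_
    exact (hlin _ _ (s (g m)).2 (s (g n)).2).resolve_left (hg m n hmn)
  let F (i : ℕ) : Upfamily X := ofFilter ((Filter.atTop : Filter ℕ).map fun n => u (2 * n + i))
  have mem_F (i : ℕ) (C : Set X) : C ∈ (F i).1 ↔ ∀ᶠ n in Filter.atTop, u (2 * n + i) ∈ C := Iff.rfl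
  have mem_mul_F (i j : ℕ) (C : Set X) : C ∈ (F i * F j).1 ↔
      ∀ᶠ m in Filter.atTop, ∀ᶠ n in Filter.atTop, u (2 * m + i) * u (2 * n + j) ∈ C :=
    mem_ofFilter_mul
  have hF : (∀ i j, F i * F j = F i) ∨ ∀ i j, F i * F j = F j := by
    refine hmono.imp (fun hmono i j => ext_mem fun C => ?_) fun hmono i j => ext_mem fun C => ?_
    · rw [mem_mul_F, mem_F]
      refine Filter.eventually_congr (Filter.Eventually.of_forall fun m => ?_)
      rw [Filter.eventually_congr (q := fun _ => u (2 * m + i) ∈ C), Filter.eventually_const]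
      filter_upwards [Filter.eventually_gt_atTop (m + i)] with n hn
      rw [hmono _ _ (by omega)]
    · rw [mem_mul_F, mem_F, ← Filter.eventually_const (f := (Filter.atTop : Filter ℕ))
        (p := ∀ᶠ n in Filter.atTop, u (2 * n + j) ∈ C)]
      refine Filter.eventually_congr (Filter.Eventually.of_forall fun m => ?_)
      refine Filter.eventually_congr ?_
      filter_upwards [Filter.eventually_gt_atTop (m + i)] with n hn
      rw [hmono _ _ (by omega)]
  have h01 : F 0 = F 1 := by
    have key := h (F 0) (ofFilter_mem_phiS _) (F 1) (ofFilter_mem_phiS _)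
      (hF.elim (fun h => h 0 0) fun h => h 0 0) (hF.elim (fun h => h 1 1) fun h => h 1 1)
    rcases hF with hF | hF
    · rwa [hF, hF] at key
    · rw [hF, hF] at key
      exact key.symm
  have hmem : range (fun n => u (2 * n)) ∈ (F 1).1 := by
    rw [← h01, mem_F]
    exact Filter.Eventually.of_forall fun n => ⟨n, rfl⟩
  obtain ⟨n, m, hm⟩ := ((mem_F _ _).1 hmem).exists
  have := hu hm
  omega

end Consequences

section Classification

/-- A finite set of idempotents on which the operation is commutative and linear is a copy of
some `Lₙ`. -/
theorem exists_L_embedding {X : Type*} [Semigroup X] {S : Set X} (hfin : S.Finite)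
    (hcomm : ∀ x y : X, x * y = y * x) (hidem : ∀ x ∈ S, x * x = x)
    (hlin : ∀ x ∈ S, ∀ y ∈ S, x * y = x ∨ x * y = y) :
    ∃ (n : ℕ) (f : L n → X), Function.Injective f ∧ range f = S ∧
      ∀ i j, f (i * j) = f i * f j := by
  classical
  let _ : LinearOrder S :=
    { le := fun x y => (x * y : X) = x
      le_refl := fun x => hidem x x.2
      le_trans := fun x y z (hxy : (x * y : X) = x) (hyz : (y * z : X) = y) =>
        show (x * z : X) = x by rw [← hxy, mul_assoc, hyz]
      le_antisymm := fun x y (hxy : (x * y : X) = x) (hyx : (y * x : X) = y) =>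
        Subtype.ext (by rw [← hxy, hcomm, hyx])
      le_total := fun x y => (hlin x x.2 y y.2).imp id fun h => (hcomm y x).trans h
      toDecidableLE := Classical.decRel _ }
  let _ := hfin.fintype
  let o : Fin (Fintype.card S) ≃o S := Fintype.orderIsoFinOfCardEq S rfl
  have hle {i j : Fin (Fintype.card S)} (hij : i ≤ j) : (o i * o j : X) = o i :=
    o.monotone hij
  refine ⟨Fintype.card S, fun i => o i, fun i j hij => o.injective (Subtype.ext hij), ?_, ?_⟩
  · ext x
    exact ⟨fun ⟨i, hi⟩ => hi ▸ (o i).2, fun hx => ⟨o.symm ⟨x, hx⟩, by simp⟩⟩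
  · intro i j
    change (o (min (α := Fin _) i j) : X) = o i * o j
    rcases le_total (α := Fin (Fintype.card S)) i j with hij | hij
    · rw [min_eq_left hij, hle hij]
    · rw [min_eq_right hij, hcomm, hle hij]

theorem classification {X : Type*} [Semigroup X] (hcomm : ∀ x y : X, x * y = y * x)
    (hcube : ∀ x : X, x * x * x = x) (hfin : {e : X | e * e = e}.Finite)
    (hlin : ∀ e f : X, e * e = e → f * f = f → e * f = e ∨ e * f = f)
    (hgrp : ∀ x y : X, y * y = x * x → x * y = x * x ∨ x * y = x ∨ x * y = y)
    (htop : ∀ x f : X, f * f = f → x * x * f = x * x → x * x = x ∨ x * x = f) :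
    (∃ n : ℕ, Nonempty (X ≃* L n)) ∨ ∃ n : ℕ, Nonempty (X ≃* OSum (L n) (Cgrp 2)) := by
  by_cases hall : ∀ x : X, x * x = x
  · left
    obtain ⟨n, f, hinj, hrange, hmul⟩ := exists_L_embedding hfin hcomm (fun x hx => hx)
      (fun x hx y hy => hlin x y hx hy)
    refine ⟨n, ⟨(MulEquiv.ofBijective (⟨f, hmul⟩ : L n →ₙ* X) ⟨hinj, fun x => ?_⟩).symm⟩⟩
    exact hrange.ge (hall x)
  right
  push Not at hall
  obtain ⟨x, hx⟩ := hall
  generalize he : x * x = e at hx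
  have hee : e * e = e := by rw [← he, ← mul_assoc, hcube]
  have hex : e * x = x := by rw [← he, hcube]
  have hef {f : X} (hf : f * f = f) : e * f = f := by
    rcases hlin e f hee hf with h | h
    · rcases htop x f hf (by rw [he, h]) with h' | h'
      · exact absurd (he.symm.trans h') hx
      · rw [← h', he, hee]
    · exact h
  have hfx {f : X} (hf : f * f = f) (hfe : f ≠ e) : f * x = f := by
    have hsq : f * x * (f * x) = f := by
      calc f * x * (f * x) = f * f * (x * x) := by
            rw [mul_assoc, ← mul_assoc x, hcomm x f]; simp only [mul_assoc]
        _ = f := by rw [hf, he, hcomm, hef hf]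
    rcases htop (f * x) e hee (by rw [hsq, hcomm, hef hf]) with h | h
    · rw [← h, hsq]
    · exact absurd (hsq.symm.trans h) hfe
  have hnon {y : X} (hy : y * y ≠ y) : y = x := by
    have hyy : y * y * (y * y) = y * y := by rw [← mul_assoc, hcube]
    have hye : y * y = e := (htop y e hee (by rw [hcomm, hef hyy])).resolve_left hy
    have hey : e * y = y := by rw [← hye, hcube]
    have hxxy : x * (x * y) = y := by rw [← mul_assoc, he, hey]
    rcases hgrp x y (by rw [hye, he]) with h | h | h
    · rw [← hxxy, h, ← mul_assoc, hcube]
    · rw [h, he] at hxxy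
      exact absurd (by rw [← hxxy, hee]) hy
    · have : x * y * y = e := by rw [h, hye]
      rw [mul_assoc, hye, hcomm, hex] at this
      exact absurd this.symm hx
  obtain ⟨n, f, hinj, hrange, hmul⟩ :=
    exists_L_embedding (S := {f : X | f * f = f ∧ f ≠ e}) (hfin.subset fun f hf => hf.1) hcomm
      (fun f hf => hf.1) (fun f hf g hg => hlin f g hf.1 hg.1)
  have hf (i : L n) : f i * f i = f i ∧ f i ≠ e := hrange.le ⟨i, rfl⟩
  have hfne (i : L n) : f i ≠ x := fun h => hx (by rw [← he, ← h, (hf i).1])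
  let g (z : Cgrp 2) : X := if z = 1 then e else x
  have hC : ∀ z : Cgrp 2, z = 1 ∨ z = Multiplicative.ofAdd 1 := by decide
  have hg1 : g 1 = e := if_pos rfl
  have hgx : g (Multiplicative.ofAdd 1) = x := if_neg (by decide)
  have hfg (i : L n) (z : Cgrp 2) : f i * g z = f i := by
    rcases hC z with rfl | rfl
    · rw [hg1, hcomm, hef (hf i).1]
    · rw [hgx, hfx (hf i).1 (hf i).2]
  let φ : OSum (L n) (Cgrp 2) →ₙ* X :=
    { toFun := Sum.elim f g
      map_mul' := by
        rintro (i | z) (j | w)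
        · exact hmul i j
        · exact (hfg i w).symm
        · exact ((hcomm _ _).trans (hfg j z)).symm
        · change g (z * w) = g z * g w
          rcases hC z with rfl | rfl <;> rcases hC w with rfl | rfl
          · rw [one_mul, hg1, hee]
          · rw [one_mul, hg1, hgx, hex]
          · rw [mul_one, hg1, hgx, hcomm, hex]
          · rw [hgx, he, show (Multiplicative.ofAdd 1 * Multiplicative.ofAdd 1 : Cgrp 2) = 1 by
              decide, hg1] }
  refine ⟨n, ⟨(MulEquiv.ofBijective φ ⟨?_, fun y => ?_⟩).symm⟩⟩
  · refine Function.Injective.sumElim hinj (fun z w hzw => ?_) fun i z => ?_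
    · rcases hC z with rfl | rfl <;> rcases hC w with rfl | rfl
      · rfl
      · exact absurd (by rw [← hg1, hzw, hgx]) hx
      · exact absurd (by rw [← hg1, ← hzw, hgx]) hx
      · rfl
    · rcases hC z with rfl | rfl
      · rw [hg1]; exact (hf i).2
      · rw [hgx]; exact hfne i
  · by_cases hy : y * y = y
    · by_cases hye : y = e
      · exact ⟨Sum.inr 1, hg1.trans hye.symm⟩
      · obtain ⟨i, hi⟩ := hrange.ge (show y ∈ {f : X | f * f = f ∧ f ≠ e} from ⟨hy, hye⟩)
        exact ⟨Sum.inl i, hi⟩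
    · exact ⟨Sum.inr (Multiplicative.ofAdd 1), hgx.trans (hnon hy).symm⟩

end Classification

section FiniteModels

theorem phiS_comm_clifford_of_finite {X : Type*} [Semigroup X] [Finite X]
    (hcomm : ∀ x y : X, x * y = y * x)
    (hmem : ∀ x y z : X, x * y * z = x ∨ x * y * z = y ∨ x * y * z = z) :
    commOn (phiS X) ∧ cliffordOn (phiS X) := by
  let _ := Upfamily.semigroup X
  refine ⟨fun F hF G hG => ?_, cliffordOn_of_cube mulClosed_phiS fun F hF => ?_⟩
  · obtain ⟨A, hA, rfl⟩ := exists_gen_eq hF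
    obtain ⟨B, hB, rfl⟩ := exists_gen_eq hG
    refine ext_mem fun C => ?_
    rw [Upfamily.mem_mul, Upfamily.mem_mul]
    exact ⟨fun h b hb a ha => by simpa only [mem_ofPred_eq, hcomm b] using h ha hb,
      fun h a ha b hb => by simpa only [mem_ofPred_eq, hcomm a] using h hb ha⟩
  · obtain ⟨A, hA, rfl⟩ := exists_gen_eq hF
    refine ext_mem fun C => ?_
    rw [Upfamily.mem_mul, Upfamily.mem_mul]
    constructor
    · intro h a ha
      have haaa : a * a * a = a := by simpa using hmem a a a
      exact haaa ▸ h ha ha ha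
    · intro h a ha b hb c hc
      apply h
      rcases hmem a b c with h | h | h <;> simpa only [h]

theorem phiS_comm_clifford_of_mulEquiv {X Y : Type*} [Semigroup X] [Mul Y] [Finite Y]
    (e : X ≃* Y) (hcomm : ∀ x y : Y, x * y = y * x)
    (hmem : ∀ x y z : Y, x * y * z = x ∨ x * y * z = y ∨ x * y * z = z) :
    commOn (phiS X) ∧ cliffordOn (phiS X) := by
  have : Finite X := Finite.of_equiv Y e.symm.toEquiv
  refine phiS_comm_clifford_of_finite (fun x y => e.injective ?_) fun x y z => ?_
  · rw [map_mul, map_mul, hcomm]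
  · simpa only [← map_mul, e.injective.eq_iff] using hmem (e x) (e y) (e z)

instance (n : ℕ) : Finite (L n) := inferInstanceAs (Finite (Fin n))

theorem L.mul_comm {n : ℕ} (i j : L n) : i * j = j * i := min_comm (α := Fin n) i j

theorem L.mul_eq_or {n : ℕ} (i j : L n) : i * j = i ∨ i * j = j := min_choice (α := Fin n) i j

theorem L.mul_mul_eq_or {n : ℕ} (i j k : L n) :
    i * j * k = i ∨ i * j * k = j ∨ i * j * k = k := by
  rcases L.mul_eq_or i j with h | h <;> rw [h]
  · exact (L.mul_eq_or i k).imp id Or.inr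
  · exact Or.inr (L.mul_eq_or j k)

theorem Cgrp_two_mul_mul_eq_or : ∀ x y z : Cgrp 2,
    x * y * z = x ∨ x * y * z = y ∨ x * y * z = z := by
  decide

namespace OSum

variable {A B : Type*} [Mul A] [Mul B]

theorem mul_comm (hA : ∀ x y : A, x * y = y * x) (hB : ∀ x y : B, x * y = y * x) :
    ∀ x y : OSum A B, x * y = y * x := by
  rintro (a | b) (a' | b')
  exacts [congrArg Sum.inl (hA a a'), rfl, rfl, congrArg Sum.inr (hB b b')]

theorem mul_mul_eq_or (hA : ∀ x y : A, x * y = x ∨ x * y = y)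
    (hA' : ∀ x y z : A, x * y * z = x ∨ x * y * z = y ∨ x * y * z = z)
    (hB : ∀ x y z : B, x * y * z = x ∨ x * y * z = y ∨ x * y * z = z) :
    ∀ x y z : OSum A B, x * y * z = x ∨ x * y * z = y ∨ x * y * z = z := by
  have inl_or {a a' : A} (h : a * a' = a ∨ a * a' = a') :
      (Sum.inl (a * a') : OSum A B) = Sum.inl a ∨ (Sum.inl (a * a') : OSum A B) = Sum.inl a' :=
    h.imp (congrArg _) (congrArg _)
  rintro (a | b) (a' | b') (a'' | b'')
  · exact (hA' a a' a'').imp (congrArg _) (Or.imp (congrArg _) (congrArg _))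
  · exact (inl_or (hA a a')).imp id Or.inl
  · exact (inl_or (hA a a'')).imp id Or.inr
  · exact Or.inl rfl
  · exact Or.inr (inl_or (hA a' a''))
  · exact Or.inr (Or.inl rfl)
  · exact Or.inr (Or.inr rfl)
  · exact (hB b b' b'').imp (congrArg _) (Or.imp (congrArg _) (congrArg _))

end OSum

end FiniteModels

/-- Theorem 1.2: for a semigroup `X`, the following are equivalent:
(1) `φ(X)` is a commutative Clifford semigroup;
(2) `φ(X)` is an inverse semigroup;
(3) the idempotents of `φ(X)` commute and `φ(X)` is sub-Clifford or regular in `N₂(X)`;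
(4) `X` is isomorphic to one of `C₂`, `Lₙ`, or `Lₙ⊔C₂` for some `n ∈ ω`. -/
theorem filters_inverse_characterization (X : Type*) [Semigroup X] :
    List.TFAE
      [commOn (phiS X) ∧ cliffordOn (phiS X),
        inverseOn (phiS X),
        idemCommOn (phiS X) ∧ (subCliffordOn (phiS X) ∨ regularIn (phiS X) (N2S X)),
        Nonempty (X ≃* Cgrp 2) ∨ (∃ n : ℕ, Nonempty (X ≃* L n)) ∨
          (∃ n : ℕ, Nonempty (X ≃* OSum (L n) (Cgrp 2)))] := by
  let _ := Upfamily.semigroup X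
  tfae_have 1 → 2 := fun h => inverseOn_of_commOn h.1 h.2
  tfae_have 2 → 3 := fun h => by
    refine ⟨idemCommOn_of_inverseOn mulClosed_phiS h, Or.inr fun F hF => ?_⟩
    obtain ⟨G, ⟨hG, hFG, -⟩, -⟩ := h F hF
    exact ⟨G, phiS_subset_N2S hG, hFG⟩
  tfae_have 3 → 4 := fun ⟨hidem, h⟩ => by
    have hX := idem_comm_of_phiS hidem
    have hcube : ∀ x : X, x * x * x = x := h.elim (fun h => h.cube) fun h => h.cube hX
    have hcomm := mul_comm_of_cube hX hcube
    have hlin (e f : X) (he : e * e = e) (hf : f * f = f) := idem_mul_eq_or h hcomm he hf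
    exact Or.inr (classification hcomm hcube (finite_idem hidem hlin) hlin
      (fun _ _ => mul_eq_of_sq_eq h hcomm hcube) fun _ _ => sq_eq_of_sq_mul_eq h hcomm hcube)
  tfae_have 4 → 1 := by
    rintro (⟨⟨e⟩⟩ | ⟨n, ⟨e⟩⟩ | ⟨n, ⟨e⟩⟩)
    · exact phiS_comm_clifford_of_mulEquiv e mul_comm Cgrp_two_mul_mul_eq_or
    · exact phiS_comm_clifford_of_mulEquiv e L.mul_comm L.mul_mul_eq_or
    · exact phiS_comm_clifford_of_mulEquiv e (OSum.mul_comm L.mul_comm mul_comm)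
        (OSum.mul_mul_eq_or L.mul_eq_or L.mul_mul_eq_or Cgrp_two_mul_mul_eq_or)
  tfae_finish
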